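/- arXiv:0804.2469 — 4 statements merged into one kernel-verified Lean document; each statement's English description precedes it below -/
import Mathlib

section
/- Let P and Q be probability measures on Ω = Σ^ℕ with d_TV(P,Q) ≤ 1/e. Then for every t ≥ 1: |H^t(P) − H^t(Q)| ≤ (log|Σ| + (1/t)·log(1/d_{TV,t}(P,Q))) · d_{TV,t}(P,Q), with the convention 0·log(∞) := 0 in case d_{TV,t}(P,Q) = 0. -/
open MeasureTheory Filter
open scoped ENNReal

variable {α : Type*}

/-- The cylinder set of sequences in `Ω = Σ^ℕ` whose first `t` symbols are `v`. -/
def cylinder (t : ℕ) (v : Fin t → α) : Set (ℕ → α) :=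
  {ω | ∀ i : Fin t, ω (i : ℕ) = v i}

variable [Fintype α] [Nonempty α] [MeasurableSpace α] [DiscreteMeasurableSpace α]

/-- `P(v)`, the probability that the source emits the word `v`. -/
noncomputable def wordProb (P : Measure (ℕ → α)) {t : ℕ} (v : Fin t → α) : ℝ :=
  (P (cylinder t v)).toReal

/-- `H^t(P)`, the entropy of the induced distribution on words of length `t`, divided
by `t` (natural logarithm; the convention `0 · log 0 = 0` holds since `Real.log 0 = 0`). -/
noncomputable def Hn (P : Measure (ℕ → α)) (t : ℕ) : ℝ :=
  -(1 / (t : ℝ)) * ∑ v : Fin t → α, wordProb P v * Real.log (wordProb P v)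

/-- `d_{TV,t}(P,Q) = Σ_{v ∈ Σ^t} |P(v) − Q(v)|`. -/
noncomputable def dTVt (P Q : Measure (ℕ → α)) (t : ℕ) : ℝ :=
  ∑ v : Fin t → α, |wordProb P v - wordProb Q v|

/-- `d_TV(P,Q) = sup_{t ∈ ℕ} d_{TV,t}(P,Q)`. -/
noncomputable def dTV (P Q : Measure (ℕ → α)) : ℝ := ⨆ t : ℕ, dTVt P Q t

open Real in
/-- Modulus of continuity of `x ↦ -x log x` on `[0, 1]`, for ordered arguments. -/
theorem abs_negMulLog_sub_le_of_le {x y : ℝ} (hx : 0 ≤ x) (hxy : x ≤ y) (hy : y ≤ 1)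
    (hd : y - x ≤ 1 / exp 1) :
    |negMulLog y - negMulLog x| ≤ negMulLog (y - x) := by
  rcases hxy.eq_or_lt with rfl | hlt
  · simp
  have hd0 : 0 < y - x := sub_pos.2 hlt
  have hy0 : 0 < y := hx.trans_lt hlt
  have hlogd : log (y - x) ≤ -1 := by
    have h := log_le_log hd0 hd
    rwa [one_div, log_inv, log_exp] at h
  have hxlog : x * log x ≤ x * log y ∧ x * (log y - log x) ≤ y - x := by
    rcases hx.eq_or_lt with rfl | hx0
    · simpa using hy0.le
    refine ⟨mul_le_mul_of_nonneg_left (log_le_log hx0 hxy) hx, ?_⟩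
    have h := log_le_sub_one_of_pos (div_pos hy0 hx0)
    rw [log_div hy0.ne' hx0.ne'] at h
    calc x * (log y - log x) ≤ x * (y / x - 1) := mul_le_mul_of_nonneg_left h hx
      _ = y - x := by field_simp
  have hdlog : (y - x) * log (y - x) ≤ (y - x) * log y :=
    mul_le_mul_of_nonneg_left (log_le_log hd0 (by linarith)) hd0.le
  have hylog : (y - x) * log y ≤ 0 :=
    mul_nonpos_of_nonneg_of_nonpos hd0.le (log_nonpos hy0.le hy)
  have hdlow : (y - x) * log (y - x) ≤ (y - x) * (-1) :=
    mul_le_mul_of_nonneg_left hlogd hd0.le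
  simp only [negMulLog]
  rw [abs_le]
  constructor <;> linarith [hxlog.1, hxlog.2]

open Real in
/-- Modulus of continuity of `x ↦ -x log x` on `[0, 1]`. -/
theorem abs_negMulLog_sub_le {x y : ℝ} (hx : 0 ≤ x) (hx1 : x ≤ 1) (hy : 0 ≤ y) (hy1 : y ≤ 1)
    (hd : |x - y| ≤ 1 / exp 1) :
    |negMulLog x - negMulLog y| ≤ negMulLog |x - y| := by
  rcases le_total x y with h | h
  · rw [abs_sub_comm x y, abs_of_nonneg (sub_nonneg.2 h)] at *
    rw [abs_sub_comm]
    exact abs_negMulLog_sub_le_of_le hx h hy1 hd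
  · rw [abs_of_nonneg (sub_nonneg.2 h)] at *
    exact abs_negMulLog_sub_le_of_le hy h hx1 hd

open Real in
/-- Among nonnegative families with a given total, the constant one maximizes the entropy. -/
theorem sum_negMulLog_le {ι : Type*} [Fintype ι] [Nonempty ι] (f : ι → ℝ) (hf : ∀ i, 0 ≤ f i) :
    ∑ i, negMulLog (f i) ≤ (log (Fintype.card ι) + log (1 / ∑ i, f i)) * ∑ i, f i := by
  set S := ∑ i, f i with hS
  have hS0 : 0 ≤ S := Finset.sum_nonneg fun i _ => hf i
  rcases hS0.eq_or_lt with h0 | hpos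
  · have hz : ∀ i, f i = 0 := fun i =>
      (Finset.sum_eq_zero_iff_of_nonneg fun i _ => hf i).1 h0.symm i (Finset.mem_univ i)
    simp [← h0, hz]
  have hN : (0 : ℝ) < Fintype.card ι := by exact_mod_cast Fintype.card_pos
  set N : ℝ := (Fintype.card ι : ℝ)
  have hterm : ∀ i, negMulLog (f i) ≤ f i * (log N + log (1 / S)) + (S / N - f i) := by
    intro i
    rcases (hf i).eq_or_lt with hi | hi
    · simpa [← hi] using (div_pos hpos hN).le
    have h := log_le_sub_one_of_pos (div_pos (div_pos hpos hN) hi)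
    rw [log_div (div_pos hpos hN).ne' hi.ne', log_div hpos.ne' hN.ne'] at h
    have h' := mul_le_mul_of_nonneg_left h hi.le
    have he : f i * (S / N / f i - 1) = S / N - f i := by field_simp
    rw [he] at h'
    rw [negMulLog, one_div, log_inv]
    linarith
  calc ∑ i, negMulLog (f i)
      ≤ ∑ i, (f i * (log N + log (1 / S)) + (S / N - f i)) :=
        Finset.sum_le_sum fun i _ => hterm i
    _ = (log N + log (1 / S)) * S := by
        rw [Finset.sum_add_distrib, ← Finset.sum_mul, Finset.sum_sub_distrib, ← hS,
          Finset.sum_const, Finset.card_univ, nsmul_eq_mul, mul_div_cancel₀ _ hN.ne']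
        ring

theorem wordProb_nonneg (P : Measure (ℕ → α)) {t : ℕ} (v : Fin t → α) : 0 ≤ wordProb P v :=
  ENNReal.toReal_nonneg

theorem wordProb_le_one (P : Measure (ℕ → α)) [IsProbabilityMeasure P] {t : ℕ}
    (v : Fin t → α) : wordProb P v ≤ 1 :=
  measureReal_le_one

theorem measurableSet_wordCylinder (t : ℕ) (v : Fin t → α) : MeasurableSet (cylinder t v) := by
  simp only [_root_.cylinder, Set.ofPred_forall]
  exact MeasurableSet.iInter fun i =>
    measurableSet_eq_fun (measurable_pi_apply (i : ℕ)) measurable_const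

theorem sum_wordProb_le_one (P : Measure (ℕ → α)) [IsProbabilityMeasure P] (t : ℕ) :
    ∑ v : Fin t → α, wordProb P v ≤ 1 := by
  have hdisj : Pairwise (Function.onFun Disjoint fun v : Fin t → α => cylinder t v) := by
    intro v w hvw
    refine Set.disjoint_left.2 fun ω hv hw => hvw (funext fun i => ?_)
    exact (hv i).symm.trans (hw i)
  calc ∑ v : Fin t → α, wordProb P v = P.real (⋃ v : Fin t → α, cylinder t v) :=
        (measureReal_iUnion_fintype hdisj (measurableSet_wordCylinder t)).symm
    _ ≤ 1 := measureReal_le_one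

theorem dTVt_le_two (P Q : Measure (ℕ → α)) [IsProbabilityMeasure P] [IsProbabilityMeasure Q]
    (t : ℕ) : dTVt P Q t ≤ 2 := by
  calc dTVt P Q t ≤ ∑ v : Fin t → α, (wordProb P v + wordProb Q v) := by
        refine Finset.sum_le_sum fun v _ => ?_
        rw [abs_le]
        constructor <;> linarith [wordProb_nonneg P v, wordProb_nonneg Q v]
    _ ≤ 2 := by
        rw [Finset.sum_add_distrib]
        linarith [sum_wordProb_le_one P t, sum_wordProb_le_one Q t]

theorem dTVt_le_dTV (P Q : Measure (ℕ → α)) [IsProbabilityMeasure P] [IsProbabilityMeasure Q]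
    (t : ℕ) : dTVt P Q t ≤ dTV P Q :=
  le_ciSup (f := dTVt P Q) ⟨2, Set.forall_mem_range.2 (dTVt_le_two P Q)⟩ t

theorem Hn_eq_sum_negMulLog (P : Measure (ℕ → α)) (t : ℕ) :
    Hn P t = (1 / (t : ℝ)) * ∑ v : Fin t → α, Real.negMulLog (wordProb P v) := by
  simp [Hn, Real.negMulLog, Finset.sum_neg_distrib]

/-- Lemma 2: for probability measures `P, Q` with `d_TV(P,Q) ≤ 1/e` and `t ≥ 1`,
`|H^t(P) − H^t(Q)| ≤ (log|Σ| + (1/t)·log(1/d_{TV,t}(P,Q))) · d_{TV,t}(P,Q)`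
(with the convention `0 · log ∞ = 0` when `d_{TV,t}(P,Q) = 0`, which holds in Lean
since `1/0 = 0` and `Real.log 0 = 0`). -/
theorem abs_Hn_sub_le (P Q : Measure (ℕ → α))
    [IsProbabilityMeasure P] [IsProbabilityMeasure Q]
    (hPQ : dTV P Q ≤ 1 / Real.exp 1) (t : ℕ) (ht : 1 ≤ t) :
    |Hn P t - Hn Q t| ≤
      (Real.log (Fintype.card α) + (1 / (t : ℝ)) * Real.log (1 / dTVt P Q t))
        * dTVt P Q t := by
  have ht0 : (0 : ℝ) < t := by exact_mod_cast ht
  have hclose : ∀ v : Fin t → α, |wordProb P v - wordProb Q v| ≤ 1 / Real.exp 1 := fun v =>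
    (Finset.single_le_sum (f := fun v : Fin t → α => |wordProb P v - wordProb Q v|)
      (fun _ _ => abs_nonneg _) (Finset.mem_univ v)).trans ((dTVt_le_dTV P Q t).trans hPQ)
  have hsum : |∑ v : Fin t → α, (Real.negMulLog (wordProb P v) - Real.negMulLog (wordProb Q v))|
      ≤ (t * Real.log (Fintype.card α) + Real.log (1 / dTVt P Q t)) * dTVt P Q t := by
    refine (Finset.abs_sum_le_sum_abs _ _).trans ((Finset.sum_le_sum fun v _ =>
      abs_negMulLog_sub_le (wordProb_nonneg P v) (wordProb_le_one P v) (wordProb_nonneg Q v)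
        (wordProb_le_one Q v) (hclose v)).trans ?_)
    have h := sum_negMulLog_le (fun v : Fin t → α => |wordProb P v - wordProb Q v|)
      fun _ => abs_nonneg _
    rwa [Fintype.card_fun, Fintype.card_fin, Nat.cast_pow, Real.log_pow] at h
  rw [Hn_eq_sum_negMulLog, Hn_eq_sum_negMulLog, ← mul_sub, ← Finset.sum_sub_distrib, abs_mul,
    abs_of_pos (one_div_pos.2 ht0)]
  calc _ ≤ 1 / (t : ℝ) *
        ((t * Real.log (Fintype.card α) + Real.log (1 / dTVt P Q t)) * dTVt P Q t) :=
        mul_le_mul_of_nonneg_left hsum (one_div_pos.2 ht0).le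
    _ = _ := by field_simp
end

section
/- Let 2 ≤ p < ∞. Then there exists ε > 0 such that for every δ > 0 there exist N ≥ 2 and x, y ∈ Δ^{N−1} with ‖x − y‖_p < δ and |h_N(x) − h_N(y)| > ε. (That is, the family of normalized entropy functions h_n fails to be uniformly equicontinuous in the p-norm, uniformly over the dimension.) -/
/-- The normalized entropy function `h_n(x) = (1/log n) · Σ_i x_i · log(1/x_i)`
(natural logarithm; the convention `0 · log ∞ = 0` holds in Lean since `1/0 = 0`
and `Real.log 0 = 0`). -/
noncomputable def hEnt (n : ℕ) (x : Fin n → ℝ) : ℝ :=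
  (1 / Real.log n) * ∑ i, x i * Real.log (1 / x i)

/-- The uniform probability vector on the first `k` of `n` coordinates. -/
noncomputable def uniformOnFirst (n k : ℕ) (i : Fin n) : ℝ :=
  if (i : ℕ) < k then (k : ℝ)⁻¹ else 0

lemma sum_ite_val_lt {n k : ℕ} (hkn : k ≤ n) (c : ℝ) :
    ∑ i : Fin n, (if (i : ℕ) < k then c else 0) = k * c := by
  rw [Fin.sum_univ_eq_sum_range (fun i => if i < k then c else 0) n, ← Finset.sum_filter]
  have h : (Finset.range n).filter (· < k) = Finset.range k := by
    ext i
    simp only [Finset.mem_filter, Finset.mem_range]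
    omega
  rw [h, Finset.sum_const, Finset.card_range, nsmul_eq_mul]

lemma uniformOnFirst_nonneg (n k : ℕ) (i : Fin n) : 0 ≤ uniformOnFirst n k i := by
  unfold uniformOnFirst
  positivity

lemma uniformOnFirst_le (n k : ℕ) (i : Fin n) : uniformOnFirst n k i ≤ (k : ℝ)⁻¹ := by
  unfold uniformOnFirst
  split_ifs
  · exact le_rfl
  · positivity

lemma sum_uniformOnFirst {n k : ℕ} (hk : 0 < k) (hkn : k ≤ n) :
    ∑ i, uniformOnFirst n k i = 1 := by
  have hk' : (k : ℝ) ≠ 0 := by positivity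
  simp only [uniformOnFirst, sum_ite_val_lt hkn, mul_inv_cancel₀ hk']

lemma uniformOnFirst_mem_stdSimplex {n k : ℕ} (hk : 0 < k) (hkn : k ≤ n) :
    uniformOnFirst n k ∈ stdSimplex ℝ (Fin n) :=
  ⟨uniformOnFirst_nonneg n k, sum_uniformOnFirst hk hkn⟩

lemma hEnt_uniformOnFirst {n k : ℕ} (hk : 0 < k) (hkn : k ≤ n) :
    hEnt n (uniformOnFirst n k) = Real.log k / Real.log n := by
  have hk' : (k : ℝ) ≠ 0 := by positivity
  have h (i : Fin n) : uniformOnFirst n k i * Real.log (1 / uniformOnFirst n k i) =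
      if (i : ℕ) < k then (k : ℝ)⁻¹ * Real.log k else 0 := by
    unfold uniformOnFirst
    split_ifs <;> simp
  simp only [hEnt, h, sum_ite_val_lt hkn, mul_inv_cancel_left₀ hk']
  ring

/-- On vectors with entries in `[0, c]`, `c ≤ 1`, the `p`-th power of the `p`-distance is at most
`c` times the total mass, for `2 ≤ p`. -/
lemma sum_abs_sub_rpow_le {ι : Type*} [Fintype ι] {p c : ℝ} (hp : 2 ≤ p) (hc : c ≤ 1)
    {x y : ι → ℝ} (hx : ∀ i, 0 ≤ x i) (hy : ∀ i, 0 ≤ y i) (hxc : ∀ i, x i ≤ c)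
    (hyc : ∀ i, y i ≤ c) :
    ∑ i, |x i - y i| ^ p ≤ c * (∑ i, x i + ∑ i, y i) := by
  rw [← Finset.sum_add_distrib, Finset.mul_sum]
  refine Finset.sum_le_sum fun i _ => ?_
  have hle : |x i - y i| ≤ c :=
    abs_sub_le_iff.2 ⟨by linarith [hy i, hxc i], by linarith [hx i, hyc i]⟩
  have hadd : |x i - y i| ≤ x i + y i :=
    abs_sub_le_iff.2 ⟨by linarith [hy i], by linarith [hx i]⟩
  calc |x i - y i| ^ p ≤ |x i - y i| ^ (2 : ℝ) :=
        Real.rpow_le_rpow_of_exponent_ge' (abs_nonneg _) (hle.trans hc) zero_le_two hp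
    _ = |x i - y i| * |x i - y i| := by rw [Real.rpow_two, sq]
    _ ≤ c * (x i + y i) :=
        mul_le_mul hle hadd (abs_nonneg _) ((hx i).trans (hxc i))

/-- For `2 ≤ p < ∞`, the family `(h_n)` fails to be uniformly equicontinuous in the
`p`-norm, uniformly over the dimension: there is `ε > 0` such that for every `δ > 0`
there are `N ≥ 2` and `x, y ∈ Δ^{N−1}` with `‖x − y‖_p < δ` and `|h_N(x) − h_N(y)| > ε`. -/
theorem hEnt_not_uniform_equicontinuous_pnorm (p : ℝ) (hp : 2 ≤ p) :
    ∃ ε : ℝ, 0 < ε ∧ ∀ δ : ℝ, 0 < δ → ∃ N : ℕ, 2 ≤ N ∧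
      ∃ x y : Fin N → ℝ, x ∈ stdSimplex ℝ (Fin N) ∧ y ∈ stdSimplex ℝ (Fin N) ∧
        (∑ i, |x i - y i| ^ p) ^ (1 / p) < δ ∧ |hEnt N x - hEnt N y| > ε := by
  have hp0 : 0 < p := by linarith
  refine ⟨1 / 4, by norm_num, fun δ hδ => ?_⟩
  obtain ⟨k, hk⟩ := exists_nat_gt (2 / δ ^ p)
  obtain ⟨m, hkm, hm⟩ : ∃ m : ℕ, k ≤ m ∧ 2 ≤ m := ⟨max k 2, le_max_left _ _, le_max_right _ _⟩
  have hm0 : 0 < m := by omega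
  have hm1 : (1 : ℝ) < m := by exact_mod_cast hm
  have hmm : m ≤ m ^ 2 := Nat.le_self_pow two_ne_zero m
  have hinv : ((m ^ 2 : ℕ) : ℝ)⁻¹ ≤ (m : ℝ)⁻¹ :=
    inv_anti₀ (by positivity) (by exact_mod_cast hmm)
  refine ⟨m ^ 2, hm.trans hmm, uniformOnFirst (m ^ 2) (m ^ 2), uniformOnFirst (m ^ 2) m,
    uniformOnFirst_mem_stdSimplex (by positivity) le_rfl,
    uniformOnFirst_mem_stdSimplex hm0 hmm, ?_, ?_⟩
  · have hsum := sum_abs_sub_rpow_le hp (inv_le_one_of_one_le₀ hm1.le)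
      (uniformOnFirst_nonneg (m ^ 2) (m ^ 2)) (uniformOnFirst_nonneg (m ^ 2) m)
      (fun i => (uniformOnFirst_le _ _ i).trans hinv) (uniformOnFirst_le (m ^ 2) m)
    rw [sum_uniformOnFirst (by positivity) le_rfl, sum_uniformOnFirst hm0 hmm] at hsum
    have hδp : 0 < δ ^ p := Real.rpow_pos_of_pos hδ p
    have hlt : (m : ℝ)⁻¹ * (1 + 1) < δ ^ p := by
      have h : 2 / δ ^ p < m := hk.trans_le (by exact_mod_cast hkm)
      rw [div_lt_iff₀ hδp] at h
      rw [inv_mul_lt_iff₀ (by positivity)]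
      linarith
    rw [one_div, Real.rpow_inv_lt_iff_of_pos (by positivity) hδ.le hp0]
    exact hsum.trans_lt hlt
  · have hlog : 0 < Real.log m := Real.log_pos hm1
    rw [hEnt_uniformOnFirst (by positivity) le_rfl, hEnt_uniformOnFirst hm0 hmm]
    have hval : Real.log (m ^ 2 : ℕ) / Real.log (m ^ 2 : ℕ) - Real.log m / Real.log (m ^ 2 : ℕ) =
        1 / 2 := by
      push_cast
      rw [Real.log_pow]
      push_cast
      field_simp
      norm_num
    rw [hval]
    norm_num [abs_of_pos]
end

section
/- Let V be a finite-dimensional real normed vector space and F : V → V a linear endomorphism with operator norm ‖F‖ ≤ 1. Then for every x ∈ V there exists x̄ ∈ V with F(x̄) = x̄ such that (1/n)·Σ_{k=0}^{n−1} F^k x converges to x̄ in norm as n → ∞. -/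
open Filter

namespace ContinuousLinearMap

variable {V : Type*} [NormedAddCommGroup V] [NormedSpace ℝ V]

/-- The Cesàro averages of a contraction tend to zero on the range of `F - 1`. -/
theorem tendsto_cesaro_avg_apply_sub_self (F : V →L[ℝ] V) (hF : ‖F‖ ≤ 1) (y : V) :
    Tendsto (fun n : ℕ => (n : ℝ)⁻¹ • ∑ k ∈ Finset.range n, (F ^ k) (F y - y))
      atTop (nhds 0) := by
  have hpow (n : ℕ) : ‖F ^ n‖ ≤ 1 := by
    induction n with
    | zero => exact norm_id_le
    | succ n ih =>
      rw [pow_succ]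
      exact (norm_mul_le _ _).trans (mul_le_one₀ ih (norm_nonneg _) hF)
  have hsum (n : ℕ) :
      ∑ k ∈ Finset.range n, (F ^ k) (F y - y) = (F ^ n) y - y := by
    simpa [pow_succ] using Finset.sum_range_sub (fun k => (F ^ k) y) n
  simp only [hsum]
  refine tendsto_inv_atTop_nhds_zero_nat.zero_smul_isBoundedUnder_le ?_
  refine isBoundedUnder_of ⟨‖y‖ + ‖y‖, fun n => (norm_sub_le _ _).trans ?_⟩
  gcongr
  simpa using (F ^ n).le_of_opNorm_le (hpow n) y

/-- The Cesàro averages of a linear map converge to `z` at a fixed point `z`. -/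
theorem tendsto_cesaro_avg_of_apply_eq_self (F : V →L[ℝ] V) {z : V} (hz : F z = z) :
    Tendsto (fun n : ℕ => (n : ℝ)⁻¹ • ∑ k ∈ Finset.range n, (F ^ k) z)
      atTop (nhds z) := by
  have hpow (k : ℕ) : (F ^ k) z = z := by
    induction k with
    | zero => simp
    | succ k ih => simp [pow_succ, hz, ih]
  refine tendsto_const_nhds.congr' ?_
  filter_upwards [eventually_ne_atTop 0] with n hn
  have hn_cast : (n : ℝ) ≠ 0 := Nat.cast_ne_zero.mpr hn
  simp [hpow, ← Nat.cast_smul_eq_nsmul ℝ, smul_smul, hn_cast]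

/-- A finite-dimensional space splits as the fixed space of a contraction `F` plus the range
of `F - 1`. -/
theorem isCompl_range_ker_sub_one [FiniteDimensional ℝ V] (F : V →L[ℝ] V) (hF : ‖F‖ ≤ 1) :
    IsCompl (F - 1 : V →L[ℝ] V).toLinearMap.range (F - 1 : V →L[ℝ] V).toLinearMap.ker := by
  refine (Submodule.isCompl_iff_disjoint _ _
    (LinearMap.finrank_range_add_finrank_ker _).ge).mpr ?_
  rw [Submodule.disjoint_def]
  rintro _ ⟨y, rfl⟩ hy
  have hfix : F (F y - y) = F y - y := by
    simpa [sub_eq_zero] using hy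
  exact tendsto_nhds_unique (F.tendsto_cesaro_avg_of_apply_eq_self hfix)
    (F.tendsto_cesaro_avg_apply_sub_self hF y)

end ContinuousLinearMap

/-- Lemma 3.2 of [Faigle–Schönhuth]: if `F : V → V` is a linear endomorphism of a
finite-dimensional real normed vector space with operator norm `‖F‖ ≤ 1`, then for
every `x ∈ V` there is an `F`-invariant `x̄ ∈ V` such that the Cesàro averages
`(1/n) Σ_{k<n} F^k x` converge to `x̄` in norm. -/
theorem cesaro_avg_tendsto_fixed_point {V : Type*} [NormedAddCommGroup V]
    [NormedSpace ℝ V] [FiniteDimensional ℝ V] (F : V →L[ℝ] V) (hF : ‖F‖ ≤ 1)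
    (x : V) :
    ∃ xbar : V, F xbar = xbar ∧
      Tendsto (fun n : ℕ => (n : ℝ)⁻¹ • ∑ k ∈ Finset.range n, (F ^ k) x)
        atTop (nhds xbar) := by
  have hx : x ∈ (F - 1 : V →L[ℝ] V).toLinearMap.range ⊔ (F - 1 : V →L[ℝ] V).toLinearMap.ker :=
    (F.isCompl_range_ker_sub_one hF).sup_eq_top ▸ Submodule.mem_top
  obtain ⟨_, ⟨y, rfl⟩, z, hz, rfl⟩ := Submodule.mem_sup.mp hx
  have hfix : F z = z := by simpa [sub_eq_zero] using hz
  refine ⟨z, hfix, ?_⟩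
  simpa [Finset.sum_add_distrib, smul_add] using
    (F.tendsto_cesaro_avg_apply_sub_self hF y).add (F.tendsto_cesaro_avg_of_apply_eq_self hfix)
end

section
/- Let P be a probability measure on Ω = Σ^ℕ of finite evolution dimension, i.e., the linear span of the family {P∘T^{−k} : k ∈ ℕ} in the real vector space of finite signed measures on Ω is finite-dimensional. Then there exists a shift-invariant (stationary) probability measure P̄ on Ω such that ‖P_n − P̄‖_TV → 0 as n → ∞, where P_n := (1/n)·Σ_{i=0}^{n−1} P∘T^{−i}. -/
open MeasureTheory Filter
open scoped ENNReal

variable {α : Type*}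

variable [Fintype α] [Nonempty α] [MeasurableSpace α] [DiscreteMeasurableSpace α]

/-- The shift operator `T` on `Ω = Σ^ℕ`: `T(v₀v₁v₂…) = v₁v₂…`. -/
def shift : (ℕ → α) → (ℕ → α) := fun ω n => ω (n + 1)

/-- `P_n := (1/n) Σ_{i=0}^{n−1} P ∘ T^{−i}` (as a measure on `Ω`). -/
noncomputable def cesaroAvg (P : Measure (ℕ → α)) (n : ℕ) : Measure (ℕ → α) :=
  (n : ℝ≥0∞)⁻¹ • ∑ i ∈ Finset.range n, P.map (shift^[i])

/-- `P_n := (1/n) Σ_{i=0}^{n−1} P ∘ T^{−i}`, as a finite signed measure on `Ω`. -/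
noncomputable def cesaroAvgS (P : Measure (ℕ → α)) [IsFiniteMeasure P] (n : ℕ) :
    SignedMeasure (ℕ → α) :=
  (n : ℝ)⁻¹ • ∑ i ∈ Finset.range n, (P.toSignedMeasure).map (shift^[i])

/-- If `1 - f` is injective on its own range, within a finite-dimensional `f`-invariant
subspace `V`, then every vector of `V` is the sum of a fixed vector and a coboundary. -/
theorem LinearMap.exists_eq_fixed_add_sub {K E : Type*} [Field K] [AddCommGroup E] [Module K E]
    (f : E →ₗ[K] E) (V : Submodule K E) [FiniteDimensional K V] (hV : ∀ x ∈ V, f x ∈ V)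
    (hf : ∀ w ∈ V, f (w - f w) = w - f w → w - f w = 0) {x : E} (hx : x ∈ V) :
    ∃ q r : E, f q = q ∧ x = q + (r - f r) := by
  set g : V →ₗ[K] V := LinearMap.id - f.restrict hV with hg
  have hgv : ∀ v : V, (g v : E) = v - f v := fun v => by simp [hg]
  have hdisj : Disjoint (LinearMap.ker g) (LinearMap.range g) := by
    rw [Submodule.disjoint_def]
    rintro _ hker ⟨w, rfl⟩
    have h0 : ((g (g w) : V) : E) = 0 := by rw [LinearMap.mem_ker.1 hker]; rfl
    rw [hgv, hgv, sub_eq_zero] at h0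
    exact Subtype.ext (by rw [hgv]; exact hf w w.2 h0.symm)
  have htop := Submodule.eq_top_of_disjoint _ _
    (by rw [add_comm, LinearMap.finrank_range_add_finrank_ker]) hdisj
  have hmem : (⟨x, hx⟩ : V) ∈ LinearMap.ker g ⊔ LinearMap.range g := htop ▸ Submodule.mem_top
  obtain ⟨q, hq, _, ⟨r, rfl⟩, hqr⟩ := Submodule.mem_sup.1 hmem
  refine ⟨q, r, ?_, ?_⟩
  · have h0 : ((g q : V) : E) = 0 := by rw [LinearMap.mem_ker.1 hq]; rfl
    rw [hgv, sub_eq_zero] at h0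
    exact h0.symm
  · rw [← hgv]
    exact (congrArg Subtype.val hqr).symm

section SignedMeasure

variable {X : Type*} [MeasurableSpace X]

theorem MeasureTheory.SignedMeasure.totalVariation_univ_le {s : SignedMeasure X} {c : ℝ}
    (hs : ∀ A, MeasurableSet A → |s A| ≤ c) : (s.totalVariation Set.univ).toReal ≤ 2 * c := by
  obtain ⟨i, hi, hpos, hneg, hp, hn⟩ := s.toJordanDecomposition_spec
  have h1 : s.toJordanDecomposition.posPart.real Set.univ ≤ c := by
    rw [hp, SignedMeasure.toMeasureOfZeroLE_real_apply s hpos hi MeasurableSet.univ,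
      Set.inter_univ]
    exact (le_abs_self _).trans (hs i hi)
  have h2 : s.toJordanDecomposition.negPart.real Set.univ ≤ c := by
    rw [hn, SignedMeasure.toMeasureOfLEZero_real_apply s hneg hi.compl MeasurableSet.univ,
      Set.inter_univ]
    exact (neg_le_abs _).trans (hs _ hi.compl)
  change s.totalVariation.real Set.univ ≤ _
  rw [SignedMeasure.totalVariation, measureReal_add_apply]
  linarith

theorem MeasureTheory.SignedMeasure.abs_apply_le_totalVariation_univ (s : SignedMeasure X)
    (A : Set X) : |s A| ≤ s.totalVariation.real Set.univ :=
  (s.norm_le_totalVariation A).trans (measureReal_mono (Set.subset_univ A))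

theorem MeasureTheory.VectorMeasure.mapₗ_pow_apply {T : X → X} (hT : Measurable T)
    (s : SignedMeasure X) (n : ℕ) :
    ((VectorMeasure.mapₗ T : SignedMeasure X →ₗ[ℝ] SignedMeasure X) ^ n) s = s.map T^[n] := by
  induction n with
  | zero => simp
  | succ n ih =>
    rw [pow_succ', Module.End.mul_apply, ih]
    ext A hA
    rw [VectorMeasure.mapₗ_apply, VectorMeasure.map_apply _ hT hA,
      VectorMeasure.map_apply _ (hT.iterate n) (hT hA),
      VectorMeasure.map_apply _ (hT.iterate (n + 1)) hA, Function.iterate_succ', Set.preimage_comp]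

theorem MeasureTheory.SignedMeasure.abs_map_iterate_apply_le {T : X → X} (hT : Measurable T)
    (s : SignedMeasure X) (n : ℕ) {A : Set X} (hA : MeasurableSet A) :
    |s.map T^[n] A| ≤ s.totalVariation.real Set.univ := by
  rw [VectorMeasure.map_apply _ (hT.iterate n) hA]
  exact s.abs_apply_le_totalVariation_univ _

/-- An invariant coboundary of signed measures vanishes, because the iterates `w.map T^[n]`
are uniformly bounded. -/
theorem MeasureTheory.SignedMeasure.sub_map_eq_zero_of_invariant {T : X → X} (hT : Measurable T)
    (w : SignedMeasure X) (hw : (w - w.map T).map T = w - w.map T) : w - w.map T = 0 := by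
  have hiter : ∀ n : ℕ, w.map T^[n] = w - (n : ℝ) • (w - w.map T) := by
    intro n
    induction n with
    | zero => simp
    | succ n ih =>
      rw [← VectorMeasure.mapₗ_pow_apply hT] at ih ⊢
      rw [pow_succ', Module.End.mul_apply, ih, map_sub, LinearMap.map_smul]
      simp only [VectorMeasure.mapₗ_apply, hw]
      push_cast
      module
  ext A hA
  by_contra hne
  change (w - w.map T) A ≠ 0 at hne
  set C := w.totalVariation.real Set.univ
  obtain ⟨n, hn⟩ := exists_nat_gt (2 * C / |(w - w.map T) A|)
  rw [div_lt_iff₀ (abs_pos.2 hne)] at hn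
  have h1 : w.map T^[n] A = w A - n * (w - w.map T) A := by rw [hiter n]; rfl
  have h2 : (n : ℝ) * |(w - w.map T) A| = |w A - w.map T^[n] A| := by
    rw [h1, sub_sub_cancel, abs_mul, Nat.abs_cast]
  have h3 := abs_sub (w A) (w.map T^[n] A)
  have h4 := w.abs_apply_le_totalVariation_univ A
  have h5 := w.abs_map_iterate_apply_le hT n hA
  linarith

/-- The average of the first `n` pushforwards of `q + (r - r.map T)` with `q` invariant. -/
theorem MeasureTheory.SignedMeasure.average_map_iterate_sub {T : X → X} (hT : Measurable T)
    {q r : SignedMeasure X} (hq : q.map T = q) {n : ℕ} (hn : n ≠ 0) :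
    (n : ℝ)⁻¹ • ∑ i ∈ Finset.range n, (q + (r - r.map T)).map T^[i] - q
      = (n : ℝ)⁻¹ • (r - r.map T^[n]) := by
  have hqi : ∀ i : ℕ, q.map T^[i] = q := by
    intro i
    induction i with
    | zero => simp
    | succ i ih =>
      rw [← VectorMeasure.mapₗ_pow_apply hT] at ih ⊢
      rw [pow_succ', Module.End.mul_apply, ih, VectorMeasure.mapₗ_apply, hq]
  have hi : ∀ i : ℕ, (q + (r - r.map T)).map T^[i] = q + (r.map T^[i] - r.map T^[i + 1]) := by
    intro i
    rw [← VectorMeasure.mapₗ_pow_apply hT, map_add, map_sub, VectorMeasure.mapₗ_pow_apply hT q,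
      hqi, ← VectorMeasure.mapₗ_pow_apply hT r, ← VectorMeasure.mapₗ_pow_apply hT r, pow_succ,
      Module.End.mul_apply, VectorMeasure.mapₗ_apply]
  have hn' : (n : ℝ) ≠ 0 := Nat.cast_ne_zero.2 hn
  rw [Finset.sum_congr rfl fun i _ => hi i, Finset.sum_add_distrib, Finset.sum_range_sub',
    Finset.sum_const, Finset.card_range, smul_add, ← Nat.cast_smul_eq_nsmul ℝ, smul_smul,
    inv_mul_cancel₀ hn', one_smul, add_sub_cancel_left]
  simp

/-- A probability measure whose orbit under pushforward by `T` spans a finite-dimensional space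
has an invariant mean, to which its Cesàro averages converge in total variation. -/
theorem MeasureTheory.exists_invariant_mean_of_finiteDimensional {T : X → X} (hT : Measurable T)
    (P : Measure X) [IsProbabilityMeasure P]
    (hfin : FiniteDimensional ℝ
      (Submodule.span ℝ (Set.range fun k : ℕ => P.toSignedMeasure.map T^[k]))) :
    ∃ (Q : Measure X) (_ : IsProbabilityMeasure Q), Q.map T = Q ∧
      Tendsto (fun n : ℕ => (SignedMeasure.totalVariation
        ((n : ℝ)⁻¹ • ∑ i ∈ Finset.range n, P.toSignedMeasure.map T^[i] - Q.toSignedMeasure)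
          Set.univ).toReal) atTop (nhds 0) := by
  set V := Submodule.span ℝ (Set.range fun k : ℕ => P.toSignedMeasure.map T^[k])
  set f : SignedMeasure X →ₗ[ℝ] SignedMeasure X := VectorMeasure.mapₗ T
  have hV : ∀ x ∈ V, f x ∈ V := by
    refine fun x hx => (Submodule.span_le (p := V.comap f)).2 ?_ hx
    rintro _ ⟨k, rfl⟩
    refine Submodule.subset_span ⟨k + 1, ?_⟩
    simp only [← VectorMeasure.mapₗ_pow_apply hT, pow_succ', Module.End.mul_apply]
    rfl
  have hPV : P.toSignedMeasure ∈ V := Submodule.subset_span ⟨0, by simp⟩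
  obtain ⟨q, r, hq, hP⟩ := f.exists_eq_fixed_add_sub V hV
    (fun w _ hw => w.sub_map_eq_zero_of_invariant hT hw) hPV
  replace hq : q.map T = q := hq
  replace hP : P.toSignedMeasure = q + (r - r.map T) := hP
  set avg : ℕ → SignedMeasure X := fun n =>
    (n : ℝ)⁻¹ • ∑ i ∈ Finset.range n, P.toSignedMeasure.map T^[i] with havg
  set C := r.totalVariation.real Set.univ
  have hbound : ∀ n : ℕ, n ≠ 0 → ∀ A, MeasurableSet A →
      |(avg n - q) A| ≤ (n : ℝ)⁻¹ * (2 * C) := by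
    intro n hn A hA
    simp only [havg, hP]
    rw [SignedMeasure.average_map_iterate_sub hT hq hn]
    change |(n : ℝ)⁻¹ * (r A - r.map T^[n] A)| ≤ _
    rw [abs_mul, abs_of_nonneg (by positivity : (0 : ℝ) ≤ (n : ℝ)⁻¹)]
    gcongr
    have h3 := abs_sub (r A) (r.map T^[n] A)
    have h4 := r.abs_apply_le_totalVariation_univ A
    have h5 := r.abs_map_iterate_apply_le hT n hA
    linarith
  have hlim : ∀ c : ℝ, Tendsto (fun n : ℕ => (n : ℝ)⁻¹ * c) atTop (nhds 0) := fun c => by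
    simpa using (tendsto_inv_atTop_nhds_zero_nat (𝕜 := ℝ)).mul_const c
  have havg_apply : ∀ n A, MeasurableSet A →
      avg n A = (n : ℝ)⁻¹ * ∑ i ∈ Finset.range n, P.real (T^[i] ⁻¹' A) := by
    intro n A hA
    simp only [havg, smul_apply, sum_apply, smul_eq_mul]
    refine congrArg _ (Finset.sum_congr rfl fun i _ => ?_)
    rw [VectorMeasure.map_apply _ (hT.iterate i) hA,
      Measure.toSignedMeasure_apply_measurable (hT.iterate i hA)]
  have hq_nonneg : 0 ≤ q := by
    intro A hA
    change 0 ≤ q A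
    refine neg_nonpos.1 (ge_of_tendsto (hlim (2 * C)) ?_)
    filter_upwards [eventually_ne_atTop 0] with n hn
    have h1 : avg n A - q A ≤ (n : ℝ)⁻¹ * (2 * C) := (le_abs_self _).trans (hbound n hn A hA)
    have h2 : 0 ≤ avg n A := by rw [havg_apply n A hA]; positivity
    linarith
  have hq_univ : q Set.univ = 1 := by
    have h := congrArg (fun s : SignedMeasure X => s Set.univ) hP
    change P.toSignedMeasure Set.univ = q Set.univ + (r Set.univ - r.map T Set.univ) at h
    rw [VectorMeasure.map_apply _ hT MeasurableSet.univ, Set.preimage_univ, sub_self, add_zero,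
      Measure.toSignedMeasure_apply_measurable MeasurableSet.univ, probReal_univ] at h
    exact h.symm
  have hq' := (VectorMeasure.le_restrict_univ_iff_le _ _).2 hq_nonneg
  set Q := q.toMeasureOfZeroLE Set.univ MeasurableSet.univ hq'
  have hQ : Q.toSignedMeasure = q := SignedMeasure.toMeasureOfZeroLE_toSignedMeasure q hq'
  have hQr : ∀ A, MeasurableSet A → Q.real A = q A := fun A hA => by
    rw [← hQ, Measure.toSignedMeasure_apply_measurable hA]
  have hQprob : IsProbabilityMeasure Q :=
    ⟨by rw [← ENNReal.toReal_eq_one_iff]; exact (hQr _ MeasurableSet.univ).trans hq_univ⟩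
  refine ⟨Q, hQprob, ?_, ?_⟩
  · ext A hA
    rw [Measure.map_apply hT hA, ← measureReal_eq_measureReal_iff, hQr _ (hT hA), hQr _ hA,
      ← VectorMeasure.map_apply _ hT hA, hq]
  · rw [hQ]
    refine squeeze_zero' (Eventually.of_forall fun n => ENNReal.toReal_nonneg) ?_
      (hlim (2 * (2 * C)))
    filter_upwards [eventually_ne_atTop 0] with n hn
    refine (SignedMeasure.totalVariation_univ_le (hbound n hn)).trans (le_of_eq ?_)
    ring

end SignedMeasure

/-- Theorem 2: if `P` has finite evolution dimension (the span of the pushforwards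
`P ∘ T^{−k}`, `k ∈ ℕ`, in the space of finite signed measures is finite-dimensional),
then there is a stationary (shift-invariant) probability measure `P̄`, the stationary
mean of `P`, with `‖P_n − P̄‖_TV → 0`. -/
theorem exists_stationary_mean (P : Measure (ℕ → α)) [IsProbabilityMeasure P]
    (hfin : FiniteDimensional ℝ
      (Submodule.span ℝ (Set.range fun k : ℕ => (P.toSignedMeasure).map (shift^[k])))) :
    ∃ (Pbar : Measure (ℕ → α)) (_ : IsProbabilityMeasure Pbar),
      Pbar.map shift = Pbar ∧
      Tendsto
        (fun n : ℕ => (SignedMeasure.totalVariation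
          (cesaroAvgS P n - Pbar.toSignedMeasure) Set.univ).toReal)
        atTop (nhds 0) := by
  exact exists_invariant_mean_of_finiteDimensional
    (measurable_pi_lambda _ fun n => measurable_pi_apply (n + 1)) P hfin
end
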